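/- (Invariance of the overpotential.) If (u₁,v₁) and (u₂,v₂) are two classical solutions of system (P), then v₁(x) − u₁(x) = v₂(x) − u₂(x) for all x ∈ [0,L₁] ∪ [L₁+δ, L], and in particular E(x, v₁(x) − u₁(x)) = E(x, v₂(x) − u₂(x)) for all such x. -/

import Mathlib

open Set MeasureTheory intervalIntegral

/-- The Butler–Volmer nonlinearity `E(x,w) = exp(a(w − f x)) − exp(−b(w − f x))`. -/
noncomputable def E (a b : ℝ) (f : ℝ → ℝ) (x w : ℝ) : ℝ :=
  Real.exp (a * (w - f x)) - Real.exp (-b * (w - f x))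

/-- The flux term `−(r u′) + ν·(r (ln c)′)` appearing in the electrolyte equation. -/
noncomputable def flux (r c : ℝ → ℝ) (ν : ℝ) (u : ℝ → ℝ) : ℝ → ℝ :=
  fun y => -(r y * deriv u y) + ν * (r y * deriv c y / c y)

/-- A classical solution `(u, v)` of the system. -/
def IsSolution (L₁ δ L a b ν dm dp km kp qm qp : ℝ)
    (f r c bm bp u v : ℝ → ℝ) : Prop :=
  -- `u` is continuously differentiable on `[0, L]`
  ContDiffOn ℝ 1 u (Icc 0 L) ∧
  -- `r·u′` is differentiable on `(0, L)`
  DifferentiableOn ℝ (fun y => r y * deriv u y) (Ioo 0 L) ∧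
  -- `v` is twice differentiable on `[0, L₁]` and on `[L₁+δ, L]`
  (∀ x ∈ Icc 0 L₁ ∪ Icc (L₁ + δ) L,
      DifferentiableAt ℝ v x ∧ DifferentiableAt ℝ (deriv v) x) ∧
  -- electrolyte-potential equation on the negative electrode
  (∀ x ∈ Ioo 0 L₁, deriv (flux r c ν u) x = km * bm x * E a b f x (v x - u x)) ∧
  -- electrolyte-potential equation on the separator
  (∀ x ∈ Ioo L₁ (L₁ + δ), deriv (flux r c ν u) x = 0) ∧
  -- electrolyte-potential equation on the positive electrode
  (∀ x ∈ Ioo (L₁ + δ) L, deriv (flux r c ν u) x = kp * bp x * E a b f x (v x - u x)) ∧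
  -- boundary conditions for `u`
  deriv u 0 = 0 ∧ deriv u L = 0 ∧
  -- solid-potential equation on the negative electrode (`−v″ = −(⋯)`)
  (∀ x ∈ Ioo 0 L₁, deriv (deriv v) x = qm * bm x * E a b f x (v x - u x)) ∧
  -- solid-potential equation on the positive electrode (`−v″ = −(⋯)`)
  (∀ x ∈ Ioo (L₁ + δ) L, deriv (deriv v) x = qp * bp x * E a b f x (v x - u x)) ∧
  -- boundary conditions for `v`: `−v′(0) = d₋`, `v′(L) = −d₊`, `v′(L₁) = v′(L₁+δ) = 0`
  deriv v 0 = -dm ∧ deriv v L = -dp ∧ deriv v L₁ = 0 ∧ deriv v (L₁ + δ) = 0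

open Filter Topology

/-- The nonlinearity is strictly increasing in the overpotential. -/
lemma E_strictMono {a b : ℝ} (ha : 0 < a) (hb : 0 < b) (f : ℝ → ℝ) (x : ℝ) :
    StrictMono (E a b f x) := by
  intro w₁ w₂ h
  have h1 : Real.exp (a * (w₁ - f x)) < Real.exp (a * (w₂ - f x)) :=
    Real.exp_lt_exp.2 (mul_lt_mul_of_pos_left (by linarith) ha)
  have h2 : Real.exp (-b * (w₂ - f x)) < Real.exp (-b * (w₁ - f x)) :=
    Real.exp_lt_exp.2 (by nlinarith)
  unfold E
  linarith

lemma deriv_eq_of_tendsto_left {F : ℝ → ℝ} {m e : ℝ} (hF : ∀ᶠ x in 𝓝[<] m, DifferentiableAt ℝ F x)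
    (hm : DifferentiableAt ℝ F m) (h : Tendsto (deriv F) (𝓝[<] m) (𝓝 e)) : deriv F m = e := by
  have hd : HasDerivWithinAt F e (Iic m) m :=
    hasDerivWithinAt_Iic_of_tendsto_deriv (s := {x | DifferentiableAt ℝ F x})
      (fun x hx => DifferentiableAt.differentiableWithinAt hx)
      hm.continuousAt.continuousWithinAt hF h
  exact (uniqueDiffWithinAt_Iic m).eq_deriv _ hm.hasDerivAt.hasDerivWithinAt hd

lemma deriv_eq_of_tendsto_right {F : ℝ → ℝ} {m e : ℝ}
    (hF : ∀ᶠ x in 𝓝[>] m, DifferentiableAt ℝ F x)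
    (hm : DifferentiableAt ℝ F m) (h : Tendsto (deriv F) (𝓝[>] m) (𝓝 e)) : deriv F m = e := by
  have hd : HasDerivWithinAt F e (Ici m) m :=
    hasDerivWithinAt_Ici_of_tendsto_deriv (s := {x | DifferentiableAt ℝ F x})
      (fun x hx => DifferentiableAt.differentiableWithinAt hx)
      hm.continuousAt.continuousWithinAt hF h
  exact (uniqueDiffWithinAt_Ici m).eq_deriv _ hm.hasDerivAt.hasDerivWithinAt hd

/-- If `B` vanishes at both ends and `W` at the right end, where `W' = ((r + k) B - C) / r` and
`B'` is negative wherever `W` is, then `C` cannot be negative. -/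
lemma nonneg_flux_const {p q k C : ℝ} (hpq : p < q) (hk : 0 < k) {r W B B' : ℝ → ℝ}
    (hr : ContinuousOn r (Icc p q)) (hrpos : ∀ x ∈ Icc p q, 0 < r x)
    (hW : ContinuousOn W (Icc p q)) (hB : ContinuousOn B (Icc p q))
    (hW' : ∀ x ∈ Ioo p q, HasDerivAt W (((r x + k) * B x - C) / r x) x)
    (hB' : ∀ x ∈ Ioo p q, HasDerivAt B (B' x) x)
    (hneg : ∀ x ∈ Ioo p q, W x < 0 → B' x < 0)
    (hBp : B p = 0) (hBq : B q = 0) (hWq : W q = 0) : 0 ≤ C := by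
  by_contra! hC
  set T : Set ℝ := {p} ∪ (Icc p q ∩ (fun x => (r x + k) * B x) ⁻¹' Iic C) with hT
  have hTclosed : IsClosed T := isClosed_singleton.union
    (((hr.add continuousOn_const).mul hB).preimage_isClosed_of_isClosed isClosed_Icc isClosed_Iic)
  have hTsub : T ⊆ Icc p q := by
    rintro x (hx | hx)
    · rw [mem_singleton_iff.1 hx]; exact left_mem_Icc.2 hpq.le
    · exact hx.1
  have hTc : IsCompact T := isCompact_Icc.of_isClosed_subset hTclosed hTsub
  obtain ⟨m, hmT, hmax⟩ := hTc.exists_isGreatest ⟨p, Or.inl rfl⟩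
  have hm := hTsub hmT
  have hmq : m < q := by
    refine lt_of_le_of_ne hm.2 ?_
    rintro rfl
    rcases hmT with h | h
    · exact hpq.ne' h
    · have := h.2
      simp only [mem_preimage, mem_Iic, hBq, mul_zero] at this
      linarith
  have hsub : Icc m q ⊆ Icc p q := Icc_subset_Icc_left hm.1
  have hsub' : Ioo m q ⊆ Ioo p q := Ioo_subset_Ioo_left hm.1
  have hpos : ∀ x ∈ Ioo m q, C < (r x + k) * B x := by
    intro x hx
    by_contra! h
    exact absurd (hmax (Or.inr ⟨Ioo_subset_Icc_self (hsub' hx), h⟩)) (not_le.2 hx.1)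
  have hWmono : StrictMonoOn W (Icc m q) := by
    refine strictMonoOn_of_deriv_pos (convex_Icc m q) (hW.mono hsub) fun x hx => ?_
    rw [interior_Icc] at hx
    rw [(hW' x (hsub' hx)).deriv]
    exact div_pos (sub_pos.2 (hpos x hx)) (hrpos x (Ioo_subset_Icc_self (hsub' hx)))
  have hBanti : StrictAntiOn B (Icc m q) := by
    refine strictAntiOn_of_deriv_neg (convex_Icc m q) (hB.mono hsub) fun x hx => ?_
    rw [interior_Icc] at hx
    rw [(hB' x (hsub' hx)).deriv]
    refine hneg x (hsub' hx) ?_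
    rw [← hWq]
    exact hWmono (Ioo_subset_Icc_self hx) (right_mem_Icc.2 hmq.le) hx.2
  have hBm : 0 < B m := by
    rw [← hBq]
    exact hBanti (left_mem_Icc.2 hmq.le) (right_mem_Icc.2 hmq.le) hmq
  rcases hmT with h | h
  · rw [mem_singleton_iff.1 h, hBp] at hBm
    exact hBm.false
  · have h2 : (r m + k) * B m ≤ C := h.2
    have := mul_pos (add_pos (hrpos m hm) hk) hBm
    linarith

/-- Uniqueness for the difference of two solutions on one electrode, with the interface at the
right end. -/
lemma eq_zero_of_right_interface {p q k C : ℝ} (hpq : p < q) (hk : 0 < k) {r W B B' : ℝ → ℝ}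
    (hr : ContinuousOn r (Icc p q)) (hrpos : ∀ x ∈ Icc p q, 0 < r x)
    (hW : ContinuousOn W (Icc p q)) (hB : ContinuousOn B (Icc p q))
    (hW' : ∀ x ∈ Ioo p q, HasDerivAt W (((r x + k) * B x - C) / r x) x)
    (hB' : ∀ x ∈ Ioo p q, HasDerivAt B (B' x) x)
    (hneg : ∀ x ∈ Ioo p q, W x < 0 → B' x < 0)
    (hpos : ∀ x ∈ Ioo p q, 0 < W x → 0 < B' x)
    (hBp : B p = 0) (hBq : B q = 0) (hWq : W q = 0) : ∀ x ∈ Icc p q, W x = 0 := by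
  have hC0 : 0 ≤ C := nonneg_flux_const hpq hk hr hrpos hW hB hW' hB' hneg hBp hBq hWq
  have hC1 : 0 ≤ -C := by
    refine nonneg_flux_const (W := fun x => -W x) (B := fun x => -B x) (B' := fun x => -B' x)
      hpq hk hr hrpos hW.neg hB.neg (fun x hx => ?_) (fun x hx => (hB' x hx).fun_neg)
      (fun x hx h => ?_) (by simp [hBp]) (by simp [hBq]) (by simp [hWq])
    · refine (hW' x hx).fun_neg.congr_deriv ?_
      ring
    · have := hpos x hx (by linarith)
      linarith
  have hC : C = 0 := by linarith
  subst hC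
  have hBW : ∀ x ∈ Ioo p q, 0 ≤ B' x * W x := fun x hx => by
    rcases lt_trichotomy (W x) 0 with h | h | h
    · exact (mul_pos_of_neg_of_neg (hneg x hx h) h).le
    · simp [h]
    · exact (mul_pos (hpos x hx h) h).le
  have hderiv : ∀ x ∈ Ioo p q,
      HasDerivAt (fun y => B y * W y) (B' x * W x + B x * (((r x + k) * B x - 0) / r x)) x :=
    fun x hx => (hB' x hx).fun_mul (hW' x hx)
  have hquad : ∀ x ∈ Ioo p q, 0 ≤ B x * (((r x + k) * B x - 0) / r x) := fun x hx => by
    have hrx := hrpos x (Ioo_subset_Icc_self hx)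
    have : B x * (((r x + k) * B x - 0) / r x) = (r x + k) / r x * (B x) ^ 2 := by
      field_simp
      ring
    rw [this]
    positivity
  have hmono : MonotoneOn (fun y => B y * W y) (Icc p q) := by
    refine monotoneOn_of_deriv_nonneg (convex_Icc p q) (hB.mul hW) (fun x hx => ?_) fun x hx => ?_
    · rw [interior_Icc] at hx
      exact (hderiv x hx).differentiableAt.differentiableWithinAt
    · rw [interior_Icc] at hx
      rw [(hderiv x hx).deriv]
      exact add_nonneg (hBW x hx) (hquad x hx)
  have hzero : ∀ x ∈ Icc p q, B x * W x = 0 := fun x hx => by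
    have h1 := hmono (left_mem_Icc.2 hpq.le) hx hx.1
    have h2 := hmono hx (right_mem_Icc.2 hpq.le) hx.2
    simp only [hBp, hBq, zero_mul] at h1 h2
    exact le_antisymm h2 h1
  have hint : ∀ x ∈ Ioo p q, W x = 0 := fun x hx => by
    have hev : (fun y => B y * W y) =ᶠ[𝓝 x] fun _ => 0 := by
      filter_upwards [Ioo_mem_nhds hx.1 hx.2] with y hy
      exact hzero y (Ioo_subset_Icc_self hy)
    have hd := (hderiv x hx).unique ((hasDerivAt_const x (0 : ℝ)).congr_of_eventuallyEq hev)
    have hp : B' x * W x = 0 := by linarith [hBW x hx, hquad x hx]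
    rcases lt_trichotomy (W x) 0 with h | h | h
    · exact absurd hp (mul_pos_of_neg_of_neg (hneg x hx h) h).ne'
    · exact h
    · exact absurd hp (mul_pos (hpos x hx h) h).ne'
  intro x hx
  have hcl : EqOn W (fun _ => 0) (Icc p q) := by
    refine EqOn.of_subset_closure (s := Ioo p q) hint hW continuousOn_const
      Ioo_subset_Icc_self ?_
    rw [closure_Ioo hpq.ne]
  exact hcl hx

/-- Uniqueness for the difference of two solutions on one electrode, with the interface at the
left end. -/
lemma eq_zero_of_left_interface {p q k C : ℝ} (hpq : p < q) (hk : 0 < k) {r W B B' : ℝ → ℝ}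
    (hr : ContinuousOn r (Icc p q)) (hrpos : ∀ x ∈ Icc p q, 0 < r x)
    (hW : ContinuousOn W (Icc p q)) (hB : ContinuousOn B (Icc p q))
    (hW' : ∀ x ∈ Ioo p q, HasDerivAt W (((r x + k) * B x - C) / r x) x)
    (hB' : ∀ x ∈ Ioo p q, HasDerivAt B (B' x) x)
    (hneg : ∀ x ∈ Ioo p q, W x < 0 → B' x < 0)
    (hpos : ∀ x ∈ Ioo p q, 0 < W x → 0 < B' x)
    (hBp : B p = 0) (hBq : B q = 0) (hWp : W p = 0) : ∀ x ∈ Icc p q, W x = 0 := by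
  have hI : MapsTo (fun x : ℝ => -x) (Icc (-q) (-p)) (Icc p q) := fun x hx =>
    ⟨by linarith [hx.2], by linarith [hx.1]⟩
  have hO : MapsTo (fun x : ℝ => -x) (Ioo (-q) (-p)) (Ioo p q) := fun x hx =>
    ⟨by linarith [hx.2], by linarith [hx.1]⟩
  have hn : ContinuousOn (fun x : ℝ => -x) (Icc (-q) (-p)) := continuousOn_id.neg
  have key := eq_zero_of_right_interface (p := -q) (q := -p) (k := k) (C := -C)
    (r := fun x => r (-x)) (W := fun x => W (-x)) (B := fun x => -B (-x))
    (B' := fun x => B' (-x)) (by linarith) hk (hr.comp hn hI) (fun x hx => hrpos _ (hI hx))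
    (hW.comp hn hI) (hB.comp hn hI).neg
    (fun x hx => by
      refine ((hW' _ (hO hx)).scomp x (hasDerivAt_neg x)).congr_deriv ?_
      simp only [smul_eq_mul]
      ring)
    (fun x hx => by
      refine ((hB' _ (hO hx)).scomp x (hasDerivAt_neg x)).fun_neg.congr_deriv ?_
      simp only [smul_eq_mul]
      ring)
    (fun x hx => hneg _ (hO hx)) (fun x hx => hpos _ (hO hx))
    (by simp [hBq]) (by simp [hBp]) (by simp [hWp])
  intro x hx
  simpa using key (-x) ⟨by linarith [hx.2], by linarith [hx.1]⟩

/-- On an electrode `(p, q)` the difference of the two solutions satisfies a first order system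
with a constant total current `C`. -/
lemma exists_flux_const {p q ν κ θ : ℝ} (hθ : 0 < θ)
    {r c β e₁ e₂ u₁ u₂ v₁ v₂ : ℝ → ℝ} (hpq : p < q)
    (hrpos : ∀ x ∈ Ioo p q, 0 < r x)
    (hrlc : ∀ x ∈ Ioo p q, DifferentiableAt ℝ (fun y => r y * deriv c y / c y) x)
    (hu₁ : ∀ x ∈ Ioo p q, DifferentiableAt ℝ u₁ x) (hu₂ : ∀ x ∈ Ioo p q, DifferentiableAt ℝ u₂ x)
    (hru₁ : ∀ x ∈ Ioo p q, DifferentiableAt ℝ (fun y => r y * deriv u₁ y) x)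
    (hru₂ : ∀ x ∈ Ioo p q, DifferentiableAt ℝ (fun y => r y * deriv u₂ y) x)
    (hv₁ : ∀ x ∈ Ioo p q, DifferentiableAt ℝ v₁ x ∧ DifferentiableAt ℝ (deriv v₁) x)
    (hv₂ : ∀ x ∈ Ioo p q, DifferentiableAt ℝ v₂ x ∧ DifferentiableAt ℝ (deriv v₂) x)
    (hf₁ : ∀ x ∈ Ioo p q, deriv (flux r c ν u₁) x = κ * β x * e₁ x)
    (hf₂ : ∀ x ∈ Ioo p q, deriv (flux r c ν u₂) x = κ * β x * e₂ x)
    (hg₁ : ∀ x ∈ Ioo p q, deriv (deriv v₁) x = θ * β x * e₁ x)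
    (hg₂ : ∀ x ∈ Ioo p q, deriv (deriv v₂) x = θ * β x * e₂ x) :
    ∃ C, ∀ x ∈ Ioo p q, HasDerivAt (fun y => (v₁ y - u₁ y) - (v₂ y - u₂ y))
      (((r x + κ / θ) * (deriv v₁ x - deriv v₂ x) - C) / r x) x := by
  have hflux : ∀ u : ℝ → ℝ, ∀ x ∈ Ioo p q, DifferentiableAt ℝ (fun y => r y * deriv u y) x →
      HasDerivAt (fun y => r y * deriv u y)
        (ν * deriv (fun y => r y * deriv c y / c y) x - deriv (flux r c ν u) x) x := by
    intro u x hx hd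
    have h := (hd.hasDerivAt.fun_neg.fun_add ((hrlc x hx).hasDerivAt.const_mul ν)).deriv
    have h' : deriv (flux r c ν u) x = -deriv (fun y => r y * deriv u y) x +
        ν * deriv (fun y => r y * deriv c y / c y) x := h
    refine hd.hasDerivAt.congr_deriv ?_
    rw [h']
    ring
  set A : ℝ → ℝ := fun y => (r y * deriv u₁ y - r y * deriv u₂ y) +
    κ / θ * (deriv v₁ y - deriv v₂ y) with hA
  have hAd : ∀ x ∈ Ioo p q, HasDerivAt A 0 x := by
    intro x hx
    refine (((hflux u₁ x hx (hru₁ x hx)).fun_sub (hflux u₂ x hx (hru₂ x hx))).fun_add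
      (((hv₁ x hx).2.hasDerivAt.fun_sub (hv₂ x hx).2.hasDerivAt).const_mul (κ / θ))).congr_deriv ?_
    rw [hf₁ x hx, hf₂ x hx, hg₁ x hx, hg₂ x hx]
    field_simp
    ring
  have hmid : (p + q) / 2 ∈ Ioo p q := ⟨by linarith, by linarith⟩
  refine ⟨A ((p + q) / 2), fun x hx => ?_⟩
  have hconst : A x = A ((p + q) / 2) :=
    isOpen_Ioo.is_const_of_deriv_eq_zero isPreconnected_Ioo
      (fun y hy => (hAd y hy).differentiableAt.differentiableWithinAt)
      (fun y hy => (hAd y hy).deriv) hx hmid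
  refine (((hv₁ x hx).1.hasDerivAt.fun_sub (hu₁ x hx).hasDerivAt).fun_sub
    ((hv₂ x hx).1.hasDerivAt.fun_sub (hu₂ x hx).hasDerivAt)).congr_deriv ?_
  rw [← hconst, hA]
  have := (hrpos x hx).ne'
  field_simp
  ring

section Solution

variable {L₁ δ L a b ν dm dp km kp qm qp : ℝ} {f r c bm bp u v : ℝ → ℝ}

lemma IsSolution.differentiableAt_u (h : IsSolution L₁ δ L a b ν dm dp km kp qm qp f r c bm bp u v)
    {x : ℝ} (hx : x ∈ Ioo 0 L) : DifferentiableAt ℝ u x :=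
  (h.1.differentiableOn one_ne_zero).differentiableAt (Icc_mem_nhds hx.1 hx.2)

lemma IsSolution.differentiableAt_flux
    (h : IsSolution L₁ δ L a b ν dm dp km kp qm qp f r c bm bp u v)
    (hrlc : DifferentiableOn ℝ (fun y => r y * deriv c y / c y) (Ioo 0 L))
    {x : ℝ} (hx : x ∈ Ioo 0 L) : DifferentiableAt ℝ (flux r c ν u) x :=
  (h.2.1.differentiableAt (Ioo_mem_nhds hx.1 hx.2)).fun_neg.fun_add
    ((hrlc.differentiableAt (Ioo_mem_nhds hx.1 hx.2)).const_mul ν)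

lemma IsSolution.continuousOn_sub (h : IsSolution L₁ δ L a b ν dm dp km kp qm qp f r c bm bp u v)
    {s : Set ℝ} (hs : s ⊆ Icc 0 L₁ ∪ Icc (L₁ + δ) L) (hs' : s ⊆ Icc 0 L) :
    ContinuousOn (fun x => v x - u x) s :=
  ContinuousOn.sub (fun x hx => (h.2.2.1 x (hs hx)).1.continuousAt.continuousWithinAt)
    (h.1.continuousOn.mono hs')

lemma continuousOn_E {s : Set ℝ} {w : ℝ → ℝ} (hf : Continuous f) (hw : ContinuousOn w s) :
    ContinuousOn (fun x => E a b f x (w x)) s := by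
  have hwf : ContinuousOn (fun x => w x - f x) s := hw.sub hf.continuousOn
  exact (Real.continuous_exp.comp_continuousOn (continuousOn_const.mul hwf)).sub
    (Real.continuous_exp.comp_continuousOn (continuousOn_const.mul hwf))

/-- Differentiability of the flux forces the reaction rate to vanish at the left interface. -/
lemma IsSolution.E_left_interface
    (h : IsSolution L₁ δ L a b ν dm dp km kp qm qp f r c bm bp u v)
    (hL₁ : 0 < L₁) (hδ : 0 < δ) (hL : L₁ + δ < L) (hf : Continuous f)
    (hrlc : DifferentiableOn ℝ (fun y => r y * deriv c y / c y) (Ioo 0 L))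
    (hbm : ContinuousOn bm (Icc 0 L₁)) (hbmpos : 0 < bm L₁) (hkm : 0 < km) :
    E a b f L₁ (v L₁ - u L₁) = 0 := by
  have hm : L₁ ∈ Ioo 0 L := ⟨hL₁, by linarith⟩
  have hmd := h.differentiableAt_flux hrlc hm
  have hnear : ∀ᶠ x in 𝓝 L₁, DifferentiableAt ℝ (flux r c ν u) x := by
    filter_upwards [Ioo_mem_nhds hm.1 hm.2] with x hx using h.differentiableAt_flux hrlc hx
  have hcont : ContinuousOn (fun x => km * bm x * E a b f x (v x - u x)) (Icc 0 L₁) :=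
    (continuousOn_const.mul hbm).mul (continuousOn_E hf (h.continuousOn_sub subset_union_left
      (Icc_subset_Icc_right hm.2.le)))
  have hleft := deriv_eq_of_tendsto_left (hnear.filter_mono nhdsWithin_le_nhds) hmd
    (e := km * bm L₁ * E a b f L₁ (v L₁ - u L₁)) (by
      have h1 : Tendsto (fun x => km * bm x * E a b f x (v x - u x)) (𝓝[<] L₁) _ :=
        (hcont L₁ (right_mem_Icc.2 hL₁.le)).mono_left
          (nhdsWithin_le_of_mem (mem_of_superset (Ioo_mem_nhdsLT hL₁) Ioo_subset_Icc_self))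
      refine h1.congr' ?_
      filter_upwards [Ioo_mem_nhdsLT hL₁] with x hx using (h.2.2.2.1 x hx).symm)
  have hright := deriv_eq_of_tendsto_right (hnear.filter_mono nhdsWithin_le_nhds) hmd
    (e := 0) (by
      refine tendsto_const_nhds.congr' ?_
      filter_upwards [Ioo_mem_nhdsGT (show L₁ < L₁ + δ by linarith)] with x hx
        using (h.2.2.2.2.1 x hx).symm)
  rw [hleft] at hright
  exact (mul_eq_zero.1 hright).resolve_left (mul_pos hkm hbmpos).ne'

/-- Differentiability of the flux forces the reaction rate to vanish at the right interface. -/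
lemma IsSolution.E_right_interface
    (h : IsSolution L₁ δ L a b ν dm dp km kp qm qp f r c bm bp u v)
    (hL₁ : 0 < L₁) (hδ : 0 < δ) (hL : L₁ + δ < L) (hf : Continuous f)
    (hrlc : DifferentiableOn ℝ (fun y => r y * deriv c y / c y) (Ioo 0 L))
    (hbp : ContinuousOn bp (Icc (L₁ + δ) L)) (hbppos : 0 < bp (L₁ + δ)) (hkp : 0 < kp) :
    E a b f (L₁ + δ) (v (L₁ + δ) - u (L₁ + δ)) = 0 := by
  have hm : L₁ + δ ∈ Ioo 0 L := ⟨by linarith, hL⟩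
  have hmd := h.differentiableAt_flux hrlc hm
  have hnear : ∀ᶠ x in 𝓝 (L₁ + δ), DifferentiableAt ℝ (flux r c ν u) x := by
    filter_upwards [Ioo_mem_nhds hm.1 hm.2] with x hx using h.differentiableAt_flux hrlc hx
  have hcont : ContinuousOn (fun x => kp * bp x * E a b f x (v x - u x)) (Icc (L₁ + δ) L) :=
    (continuousOn_const.mul hbp).mul (continuousOn_E hf (h.continuousOn_sub subset_union_right
      (Icc_subset_Icc_left hm.1.le)))
  have hright := deriv_eq_of_tendsto_right (hnear.filter_mono nhdsWithin_le_nhds) hmd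
    (e := kp * bp (L₁ + δ) * E a b f (L₁ + δ) (v (L₁ + δ) - u (L₁ + δ))) (by
      have h1 : Tendsto (fun x => kp * bp x * E a b f x (v x - u x)) (𝓝[>] (L₁ + δ)) _ :=
        (hcont (L₁ + δ) (left_mem_Icc.2 hL.le)).mono_left
          (nhdsWithin_le_of_mem (mem_of_superset (Ioo_mem_nhdsGT hL) Ioo_subset_Icc_self))
      refine h1.congr' ?_
      filter_upwards [Ioo_mem_nhdsGT hL] with x hx using (h.2.2.2.2.2.1 x hx).symm)
  have hleft := deriv_eq_of_tendsto_left (hnear.filter_mono nhdsWithin_le_nhds) hmd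
    (e := 0) (by
      refine tendsto_const_nhds.congr' ?_
      filter_upwards [Ioo_mem_nhdsLT (show L₁ < L₁ + δ by linarith)] with x hx
        using (h.2.2.2.2.1 x hx).symm)
  rw [hright] at hleft
  exact (mul_eq_zero.1 hleft).resolve_left (mul_pos hkp hbppos).ne'

end Solution

theorem overpotential_invariance (L₁ δ L a b ν dm dp km kp qm qp : ℝ) (f r c bm bp : ℝ → ℝ) (u₁ v₁ u₂ v₂ : ℝ → ℝ)
    (hL₁ : 0 < L₁) (hδ : 0 < δ) (hL : L₁ + δ < L)
    (ha : 0 < a) (hb : 0 < b) (hf : Continuous f)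
    (hr : ContDiffOn ℝ 1 r (Icc 0 L)) (hrpos : ∀ x ∈ Icc 0 L, 0 < r x)
    (hc : ContDiffOn ℝ 1 c (Icc 0 L)) (hcpos : ∀ x ∈ Icc 0 L, 0 < c x)
    (hc0 : deriv c 0 = 0) (hcL : deriv c L = 0)
    (hrlc : DifferentiableOn ℝ (fun y => r y * deriv c y / c y) (Ioo 0 L))
    (hbm : ContinuousOn bm (Icc 0 L₁)) (hbmpos : ∀ x ∈ Icc 0 L₁, 0 < bm x)
    (hbp : ContinuousOn bp (Icc (L₁ + δ) L)) (hbppos : ∀ x ∈ Icc (L₁ + δ) L, 0 < bp x)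
    (hkm : 0 < km) (hkp : 0 < kp) (hqm : 0 < qm) (hqp : 0 < qp)
    (hsol₁ : IsSolution L₁ δ L a b ν dm dp km kp qm qp f r c bm bp u₁ v₁)
    (hsol₂ : IsSolution L₁ δ L a b ν dm dp km kp qm qp f r c bm bp u₂ v₂) :
    ∀ x ∈ Icc (0:ℝ) L₁ ∪ Icc (L₁ + δ) L,
      v₁ x - u₁ x = v₂ x - u₂ x ∧
      E a b f x (v₁ x - u₁ x) = E a b f x (v₂ x - u₂ x) := by
  have hmem : ∀ {p q : ℝ}, 0 ≤ p → q ≤ L → Ioo p q ⊆ Ioo 0 L :=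
    fun hp hq => Ioo_subset_Ioo hp hq
  have hsubm : Icc 0 L₁ ⊆ Icc 0 L := Icc_subset_Icc_right (by linarith)
  have hsubp : Icc (L₁ + δ) L ⊆ Icc 0 L := Icc_subset_Icc_left (by linarith)
  have hsm := fun x => E_strictMono ha hb f x
  have hdiff : ∀ {g : ℝ → ℝ}, DifferentiableOn ℝ g (Ioo 0 L) → ∀ {p q : ℝ}, 0 ≤ p → q ≤ L →
      ∀ x ∈ Ioo p q, DifferentiableAt ℝ g x := fun hg _ _ hp hq x hx =>
    hg.differentiableAt (isOpen_Ioo.mem_nhds (hmem hp hq hx))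
  have hneg : ∀ {β θ x : ℝ}, 0 < β → 0 < θ → (v₁ x - u₁ x) - (v₂ x - u₂ x) < 0 →
      θ * β * E a b f x (v₁ x - u₁ x) - θ * β * E a b f x (v₂ x - u₂ x) < 0 :=
    fun hβ hθ h => sub_neg.2 (mul_lt_mul_of_pos_left (hsm _ (sub_neg.1 h)) (mul_pos hθ hβ))
  have hpos : ∀ {β θ x : ℝ}, 0 < β → 0 < θ → 0 < (v₁ x - u₁ x) - (v₂ x - u₂ x) →
      0 < θ * β * E a b f x (v₁ x - u₁ x) - θ * β * E a b f x (v₂ x - u₂ x) :=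
    fun hβ hθ h => sub_pos.2 (mul_lt_mul_of_pos_left (hsm _ (sub_pos.1 h)) (mul_pos hθ hβ))
  have hleft := (hsm L₁).injective
    ((hsol₁.E_left_interface hL₁ hδ hL hf hrlc hbm (hbmpos _ (right_mem_Icc.2 hL₁.le)) hkm).trans
    (hsol₂.E_left_interface hL₁ hδ hL hf hrlc hbm
      (hbmpos _ (right_mem_Icc.2 hL₁.le)) hkm).symm)
  have hright := (hsm (L₁ + δ)).injective
    ((hsol₁.E_right_interface hL₁ hδ hL hf hrlc hbp (hbppos _ (left_mem_Icc.2 hL.le)) hkp).trans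
    (hsol₂.E_right_interface hL₁ hδ hL hf hrlc hbp
      (hbppos _ (left_mem_Icc.2 hL.le)) hkp).symm)
  have hcm := (hsol₁.continuousOn_sub subset_union_left hsubm).sub
    (hsol₂.continuousOn_sub subset_union_left hsubm)
  have hcp := (hsol₁.continuousOn_sub subset_union_right hsubp).sub
    (hsol₂.continuousOn_sub subset_union_right hsubp)
  have hu₁ : ∀ x ∈ Ioo 0 L, DifferentiableAt ℝ u₁ x := fun x => hsol₁.differentiableAt_u
  have hu₂ : ∀ x ∈ Ioo 0 L, DifferentiableAt ℝ u₂ x := fun x => hsol₂.differentiableAt_u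
  obtain ⟨-, hru₁, hv₁, hfm₁, -, hfp₁, -, -, hgm₁, hgp₁, hv0₁, hvL₁, hvl₁, hvr₁⟩ := hsol₁
  obtain ⟨-, hru₂, hv₂, hfm₂, -, hfp₂, -, -, hgm₂, hgp₂, hv0₂, hvL₂, hvl₂, hvr₂⟩ := hsol₂
  have hBc : ∀ s ⊆ Icc 0 L₁ ∪ Icc (L₁ + δ) L,
      ContinuousOn (fun x => deriv v₁ x - deriv v₂ x) s := fun s hs x hx =>
    ((hv₁ x (hs hx)).2.continuousAt.sub (hv₂ x (hs hx)).2.continuousAt).continuousWithinAt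
  have hBd : ∀ x ∈ Icc 0 L₁ ∪ Icc (L₁ + δ) L, HasDerivAt (fun x => deriv v₁ x - deriv v₂ x)
      (deriv (deriv v₁) x - deriv (deriv v₂) x) x := fun x hx =>
    (hv₁ x hx).2.hasDerivAt.sub (hv₂ x hx).2.hasDerivAt
  have hIm : Ioo 0 L₁ ⊆ Icc 0 L₁ ∪ Icc (L₁ + δ) L :=
    Ioo_subset_Icc_self.trans subset_union_left
  have hIp : Ioo (L₁ + δ) L ⊆ Icc 0 L₁ ∪ Icc (L₁ + δ) L :=
    Ioo_subset_Icc_self.trans subset_union_right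
  have hL₁L : L₁ ≤ L := by linarith
  have hp0 : 0 ≤ L₁ + δ := by linarith
  obtain ⟨Cm, hCm⟩ := exists_flux_const hqm hL₁
    (fun x hx => hrpos x (hsubm (Ioo_subset_Icc_self hx)))
    (hdiff hrlc le_rfl hL₁L) (fun x hx => hu₁ x (hmem le_rfl hL₁L hx))
    (fun x hx => hu₂ x (hmem le_rfl hL₁L hx)) (hdiff hru₁ le_rfl hL₁L) (hdiff hru₂ le_rfl hL₁L)
    (fun x hx => hv₁ x (hIm hx)) (fun x hx => hv₂ x (hIm hx)) hfm₁ hfm₂ hgm₁ hgm₂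
  obtain ⟨Cp, hCp⟩ := exists_flux_const hqp hL
    (fun x hx => hrpos x (hsubp (Ioo_subset_Icc_self hx)))
    (hdiff hrlc hp0 le_rfl) (fun x hx => hu₁ x (hmem hp0 le_rfl hx))
    (fun x hx => hu₂ x (hmem hp0 le_rfl hx)) (hdiff hru₁ hp0 le_rfl) (hdiff hru₂ hp0 le_rfl)
    (fun x hx => hv₁ x (hIp hx)) (fun x hx => hv₂ x (hIp hx)) hfp₁ hfp₂ hgp₁ hgp₂
  have hm := eq_zero_of_right_interface hL₁ (div_pos hkm hqm) (hr.continuousOn.mono hsubm)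
    (fun x hx => hrpos x (hsubm hx)) hcm (hBc _ subset_union_left) hCm
    (fun x hx => hBd x (hIm hx))
    (fun x hx h => by
      rw [hgm₁ x hx, hgm₂ x hx]
      exact hneg (hbmpos x (Ioo_subset_Icc_self hx)) hqm h)
    (fun x hx h => by
      rw [hgm₁ x hx, hgm₂ x hx]
      exact hpos (hbmpos x (Ioo_subset_Icc_self hx)) hqm h)
    (by rw [hv0₁, hv0₂, sub_self]) (by rw [hvl₁, hvl₂, sub_self]) (sub_eq_zero.2 hleft)
  have hp := eq_zero_of_left_interface hL (div_pos hkp hqp) (hr.continuousOn.mono hsubp)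
    (fun x hx => hrpos x (hsubp hx)) hcp (hBc _ subset_union_right) hCp
    (fun x hx => hBd x (hIp hx))
    (fun x hx h => by
      rw [hgp₁ x hx, hgp₂ x hx]
      exact hneg (hbppos x (Ioo_subset_Icc_self hx)) hqp h)
    (fun x hx h => by
      rw [hgp₁ x hx, hgp₂ x hx]
      exact hpos (hbppos x (Ioo_subset_Icc_self hx)) hqp h)
    (by rw [hvr₁, hvr₂, sub_self]) (by rw [hvL₁, hvL₂, sub_self]) (sub_eq_zero.2 hright)
  intro x hx
  have heq : v₁ x - u₁ x = v₂ x - u₂ x := by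
    rcases hx with hx | hx
    · exact sub_eq_zero.1 (hm x hx)
    · exact sub_eq_zero.1 (hp x hx)
  exact ⟨heq, by rw [heq]⟩
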